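/- arXiv:1802.06188 — 2 statements merged into one kernel-verified Lean document; each statement's English description precedes it below -/
import Mathlib

section
/- For every m ≥ 1 and every n ≥ 1, the restricted Fubini number satisfies F_{n,≤m} = n! · det H_n(R_m), where R_m(j) = (−1)^{j−1}/j! for 1 ≤ j ≤ m and R_m(j) = 0 for j > m. -/
open Nat Finset

/-- Hessenberg-Toeplitz matrix `H_n(R)`: rows/columns indexed `1,…,n`;
entry `(i,j)` is `R(i-j+1)` if `i ≥ j`, `1` if `j = i+1`, `0` if `j > i+1`. -/
def hess (R : ℕ → ℚ) (n : ℕ) : Matrix (Fin n) (Fin n) ℚ :=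
  Matrix.of fun i j =>
    if (j : ℕ) ≤ (i : ℕ) then R ((i : ℕ) - (j : ℕ) + 1)
    else if (j : ℕ) = (i : ℕ) + 1 then 1 else 0

/-- Restricted Fubini numbers `F_{n,≤m}`: ordered set partitions of an
`n`-element set into nonempty blocks each of size at most `m`. -/
def fubiniRes (m n : ℕ) : ℕ :=
  ∑ k ∈ Finset.range (n + 1),
    (Finset.univ.filter fun f : Fin n → Fin k =>
      Function.Surjective f ∧
        ∀ i : Fin k, (Finset.univ.filter fun x => f x = i).card ≤ m).card

/-- The matrix obtained from `hess R n` by replacing its first column by `v`. -/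
def hessUpdate (R v : ℕ → ℚ) (n : ℕ) : Matrix (Fin n) (Fin n) ℚ :=
  Matrix.of fun i j => if (j : ℕ) = 0 then v i else hess R n i j

theorem hessUpdate_shift (R : ℕ → ℚ) (n : ℕ) : hessUpdate R (fun i => R (i + 1)) n = hess R n := by
  ext i j
  by_cases h : (j : ℕ) = 0 <;> simp only [hessUpdate, hess, h, Matrix.of_apply] <;> simp

theorem det_hessUpdate_succ_succ (R v : ℕ → ℚ) (n : ℕ) :
    (hessUpdate R v (n + 2)).det =
      v 0 * (hess R (n + 1)).det - (hessUpdate R (fun i => v (i + 1)) (n + 1)).det := by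
  have h₀ : (hessUpdate R v (n + 2)).submatrix Fin.succ (Fin.succAbove 0) = hess R (n + 1) := by
    ext i j
    simp [hessUpdate, hess]
  have h₁ : (hessUpdate R v (n + 2)).submatrix Fin.succ (Fin.succAbove 1) =
      hessUpdate R (fun i => v (i + 1)) (n + 1) := by
    ext i j
    refine Fin.cases ?_ (fun j => ?_) j
    · simp [hessUpdate]
    · rw [Matrix.submatrix_apply, show (1 : Fin (n + 2)) = Fin.succ 0 from rfl,
        Fin.succ_succAbove_succ]
      simp [hessUpdate, hess]
  rw [Matrix.det_succ_row_zero, Fin.sum_univ_succ, Fin.sum_univ_succ, Finset.sum_eq_zero,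
    Fin.succ_zero_eq_one, h₀, h₁]
  · simp [hessUpdate, hess]
    ring
  · intro j _
    simp [hessUpdate, hess]

theorem det_hessUpdate_succ (R v : ℕ → ℚ) (n : ℕ) :
    (hessUpdate R v (n + 1)).det =
      ∑ i ∈ range (n + 1), (-1) ^ i * v i * (hess R (n - i)).det := by
  induction n generalizing v with
  | zero => simp [hessUpdate]
  | succ n ih =>
    rw [det_hessUpdate_succ_succ, ih, Finset.sum_range_succ' _ (n + 1)]
    simp [pow_succ, Finset.sum_neg_distrib, sub_eq_neg_add]
    exact Finset.sum_congr rfl fun i _ => by rw [Nat.add_sub_add_right]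

theorem det_hess_succ (R : ℕ → ℚ) (n : ℕ) :
    (hess R (n + 1)).det =
      ∑ i ∈ range (n + 1), (-1) ^ i * R (i + 1) * (hess R (n - i)).det := by
  rw [← hessUpdate_shift, det_hessUpdate_succ]

/-- The number of functions `α → Fin k` all of whose fibres have a cardinality in `Q`. -/
def fiberCount (Q : ℕ → Prop) [DecidablePred Q] (α : Type*) [Fintype α] [DecidableEq α]
    (k : ℕ) : ℕ :=
  #{f : α → Fin k | ∀ i, Q #{x | f x = i}}

section fiberCount

variable (Q : ℕ → Prop) [DecidablePred Q]

theorem fiberCount_congr {α β : Type*} [Fintype α] [DecidableEq α] [Fintype β] [DecidableEq β]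
    (e : α ≃ β) (k : ℕ) : fiberCount Q α k = fiberCount Q β k := by
  refine Finset.card_equiv (e.arrowCongr (Equiv.refl _)) fun f => ?_
  simp only [mem_filter, mem_univ, true_and]
  refine forall_congr' fun i => ?_
  rw [Finset.card_equiv e (t := {x | e.arrowCongr (Equiv.refl _) f x = i}) (by simp)]

theorem card_filter_fiber_zero {α : Type*} [Fintype α] [DecidableEq α] (k : ℕ) (S : Finset α)
    (hS : Q #S) :
    #{f : α → Fin (k + 1) | (∀ i, Q #{x | f x = i}) ∧ ({x | f x = 0} : Finset α) = S} =
      fiberCount Q {x // x ∉ S} k := by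
  symm
  refine Finset.card_bij
    (fun g _ x => if h : x ∈ S then 0 else (g ⟨x, h⟩).succ) ?_ ?_ ?_
  · intro g hg
    have h₀ : ({x | (if h : x ∈ S then 0 else (g ⟨x, h⟩).succ) = 0} : Finset α) = S := by
      ext x
      by_cases h : x ∈ S <;> simp [h]
    simp only [mem_filter, mem_univ, true_and] at hg ⊢
    refine ⟨Fin.cases (by rwa [h₀]) fun i => ?_, h₀⟩
    convert hg i using 1
    symm
    refine Finset.card_bij (fun x _ => x.1) ?_ ?_ ?_
    · rintro ⟨x, hx⟩ h
      simpa [hx] using h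
    · rintro x - y - h
      exact Subtype.ext h
    · intro x hx
      by_cases h : x ∈ S
      · simp [h, (Fin.succ_ne_zero _).symm] at hx
      · exact ⟨⟨x, h⟩, by simpa [h] using hx, rfl⟩
  · intro g _ g' _ h
    funext ⟨x, hx⟩
    simpa [hx] using congrFun h x
  · intro f hf
    simp only [mem_filter, mem_univ, true_and] at hf
    obtain ⟨hQ, rfl⟩ := hf
    refine ⟨fun x => (f x.1).pred (by simpa using x.2), ?_, ?_⟩
    · simp only [mem_filter, mem_univ, true_and]
      intro i
      convert hQ i.succ using 1
      refine Finset.card_bij (fun x _ => x.1) ?_ ?_ ?_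
      · rintro ⟨x, hx⟩ h
        simpa [Fin.pred_eq_iff_eq_succ] using h
      · rintro x - y - h
        exact Subtype.ext h
      · intro x hx
        simp only [mem_filter, mem_univ, true_and] at hx
        exact ⟨⟨x, by simp [hx]⟩, by simp [hx], rfl⟩
    · funext x
      by_cases h : f x = 0 <;> simp [h]

theorem fiberCount_succ (n k : ℕ) :
    fiberCount Q (Fin n) (k + 1) =
      ∑ j ∈ range (n + 1), if Q j then n.choose j * fiberCount Q (Fin (n - j)) k else 0 := by
  have h := Finset.sum_powerset_apply_card
    (fun j => if Q j then fiberCount Q (Fin (n - j)) k else 0)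
    (x := (univ : Finset (Fin n)))
  simp only [Finset.card_univ, Fintype.card_fin, smul_eq_mul, mul_ite, mul_zero] at h
  rw [← h, fiberCount, Finset.card_eq_sum_card_fiberwise (t := univ.powerset)
    (f := fun f : Fin n → Fin (k + 1) => ({x | f x = 0} : Finset (Fin n))) (by simp [Set.MapsTo])]
  refine Finset.sum_congr rfl fun S _ => ?_
  rw [Finset.filter_filter]
  split_ifs with hS
  · rw [card_filter_fiber_zero Q k S hS]
    exact fiberCount_congr Q (Fintype.equivFinOfCardEq (by simp [Fintype.card_subtype_compl])) k
  · rw [Finset.card_eq_zero, Finset.filter_eq_empty_iff]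
    rintro f - ⟨hf, rfl⟩
    exact hS (hf 0)

variable {Q}

theorem fiberCount_eq_zero_of_lt (hQ : ¬ Q 0) {n k : ℕ} (h : n < k) :
    fiberCount Q (Fin n) k = 0 := by
  rw [fiberCount, Finset.card_eq_zero, Finset.filter_eq_empty_iff]
  intro f _ hf
  have hs : Function.Surjective f := fun i => by
    by_contra! hi
    exact hQ (by simpa [hi] using hf i)
  simpa [h.not_ge] using Fintype.card_le_of_surjective f hs

theorem fiberCount_succ_zero (Q : ℕ → Prop) [DecidablePred Q] (n : ℕ) :
    fiberCount Q (Fin (n + 1)) 0 = 0 := by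
  simp [fiberCount]

end fiberCount

theorem fubiniRes_eq_sum_fiberCount (m n : ℕ) {N : ℕ} (hN : n < N) :
    fubiniRes m n = ∑ k ∈ range N, fiberCount (fun j => 1 ≤ j ∧ j ≤ m) (Fin n) k := by
  rw [← Finset.sum_subset (Finset.range_subset_range.2 (Nat.succ_le_of_lt hN)), fubiniRes]
  · refine Finset.sum_congr rfl fun k _ => ?_
    rw [fiberCount]
    congr 1
    ext f
    rw [mem_filter, mem_filter]
    simp [Function.Surjective, forall_and, Finset.one_le_card, Finset.Nonempty]
  · intro k _ hk
    exact fiberCount_eq_zero_of_lt (by simp) (by simpa using hk)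

theorem fubiniRes_succ (m n : ℕ) :
    fubiniRes m (n + 1) = ∑ i ∈ range (n + 1),
      if i + 1 ≤ m then (n + 1).choose (i + 1) * fubiniRes m (n - i) else 0 := by
  rw [fubiniRes_eq_sum_fiberCount m (n + 1) (Nat.lt_succ_self _), Finset.sum_range_succ',
    fiberCount_succ_zero, add_zero]
  simp only [fiberCount_succ]
  rw [Finset.sum_comm, Finset.sum_range_succ']
  simp only [Nat.le_add_left, true_and, nonpos_iff_eq_zero, one_ne_zero,
    false_and, if_false, Finset.sum_const_zero, add_zero]
  refine Finset.sum_congr rfl fun i _ => ?_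
  split_ifs
  · rw [fubiniRes_eq_sum_fiberCount m (n - i) (N := n + 1) (by lia), Finset.mul_sum,
      Nat.add_sub_add_right]
  · simp

theorem fubiniRes_zero (m : ℕ) : fubiniRes m 0 = 1 := by
  simp [fubiniRes, Function.Surjective]

theorem fubiniRes_eq_det (m : ℕ) (hm : 1 ≤ m) (n : ℕ) (hn : 1 ≤ n) :
    (fubiniRes m n : ℚ) =
      (n ! : ℚ) *
        (hess (fun j => if j ≤ m then (-1 : ℚ) ^ (j - 1) / (j ! : ℚ) else 0) n).det := by
  clear hm hn
  induction n using Nat.strong_induction_on with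
  | _ n ih =>
    cases n with
    | zero => simp [fubiniRes_zero]
    | succ n =>
      rw [det_hess_succ, fubiniRes_succ, Finset.mul_sum]
      push_cast
      refine Finset.sum_congr rfl fun i hi => ?_
      have hi : i + 1 ≤ n + 1 := by simpa [Nat.lt_succ_iff] using hi
      split_ifs
      · rw [ih (n - i) (by lia), Nat.cast_choose ℚ hi, Nat.add_sub_add_right]
        have h₁ := Nat.cast_ne_zero (R := ℚ).2 (Nat.factorial_ne_zero (i + 1))
        have h₂ := Nat.cast_ne_zero (R := ℚ).2 (Nat.factorial_ne_zero (n - i))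
        field_simp
        rw [← pow_mul, mul_comm i, pow_mul]
        simp
      · simp
end

section
/- Let n ≥ 1 and let T_n = H_n(R) with R(j) = (−1)^{j−1}/j!. For any indices 1 ≤ i_1 < i_2 < ⋯ < i_l ≤ n, the principal minor of T_n obtained by deleting the rows and columns with indices i_1, …, i_l equals (F_{i_1−1}/(i_1−1)!) · Π_{k=2}^{l} (F_{i_k−i_{k−1}−1}/(i_k−i_{k−1}−1)!) · (F_{n−i_l}/(n−i_l)!), where F_j denotes the j-th Fubini number. -/
open Nat Finset

/-- Fubini numbers: the number of ordered set partitions of an `n`-element set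
into nonempty blocks (ordered partitions into `k` blocks correspond to
surjections onto `Fin k`). -/
def fubini (n : ℕ) : ℕ :=
  ∑ k ∈ Finset.range (n + 1),
    (Finset.univ.filter fun f : Fin n → Fin k => Function.Surjective f).card


/-- The number of surjections from `Fin n` onto `Fin k`. -/
def surjCount (n k : ℕ) : ℕ :=
  (Finset.univ.filter fun f : Fin n → Fin k => Function.Surjective f).card

theorem card_surjective_eq_surjCount {α : Type*} [Fintype α] [DecidableEq α] (k : ℕ) :
    Fintype.card {f : α → Fin k // Function.Surjective f} = surjCount (Fintype.card α) k := by
  rw [surjCount, ← Fintype.card_subtype]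
  refine Fintype.card_congr (Equiv.subtypeEquiv
    (Equiv.arrowCongr (Fintype.equivFin α) (Equiv.refl (Fin k))) fun f => ?_)
  exact ((Fintype.equivFin α).symm.surjective_comp f).symm

theorem surjCount_eq_zero_of_lt {n k : ℕ} (h : n < k) : surjCount n k = 0 := by
  rw [surjCount, Finset.card_eq_zero, Finset.filter_eq_empty_iff]
  intro f _ hf
  have := Fintype.card_le_of_surjective f hf
  simp only [Fintype.card_fin] at this
  omega

theorem surjCount_succ_zero (n : ℕ) : surjCount (n + 1) 0 = 0 := by
  rw [surjCount, Finset.card_eq_zero, Finset.filter_eq_empty_iff]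
  intro f
  exact (f 0).elim0

/-- Surjections onto `Fin (k + 1)` whose preimage of `0` is the complement of `t` correspond to
surjections from `t` onto `Fin k`. -/
def surjectiveFiberEquiv {α : Type*} [Fintype α] [DecidableEq α] (k : ℕ) (t : Finset α)
    (ht : t ≠ Finset.univ) :
    {f : α → Fin (k + 1) // Function.Surjective f ∧ ∀ x, f x ≠ 0 ↔ x ∈ t} ≃
      {g : t → Fin k // Function.Surjective g} where
  toFun f := ⟨fun x => (f.1 x).pred ((f.2.2 x).2 x.2), by
    intro y
    obtain ⟨x, hx⟩ := f.2.1 y.succ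
    have hxt : x ∈ t := (f.2.2 x).1 (hx ▸ Fin.succ_ne_zero y)
    exact ⟨⟨x, hxt⟩, by simp [hx]⟩⟩
  invFun g := ⟨fun x => if h : x ∈ t then (g.1 ⟨x, h⟩).succ else 0, by
    intro y
    obtain ⟨x₀, hx₀⟩ : ∃ x, x ∉ t := by
      by_contra! h
      exact ht (Finset.eq_univ_of_forall h)
    refine Fin.cases ⟨x₀, by simp [hx₀]⟩ (fun z => ?_) y
    obtain ⟨x, hx⟩ := g.2 z
    exact ⟨x, by simp [hx]⟩, by
    intro x
    by_cases h : x ∈ t <;> simp [h]⟩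
  left_inv f := by
    ext x
    by_cases hx : x ∈ t
    · simp [hx]
    · have : f.1 x = 0 := not_not.1 fun h => hx ((f.2.2 x).1 h)
      simp [hx, this]
  right_inv g := by
    ext x
    simp

theorem surjCount_succ_right (n k : ℕ) :
    surjCount n (k + 1) = ∑ j ∈ Finset.range n, n.choose j * surjCount j k := by
  have hfib (t : Finset (Fin n)) :
      ((Finset.univ.filter fun f : Fin n → Fin (k + 1) => Function.Surjective f).filter
        fun f => Finset.univ.filter (fun x => f x ≠ 0) = t).card =
      if t.card = n then 0 else surjCount t.card k := by
    split_ifs with h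
    · rw [Finset.card_eq_zero, Finset.filter_eq_empty_iff]
      intro f hf hft
      rw [Finset.mem_filter] at hf
      obtain ⟨x, hx⟩ := hf.2 0
      have : t = Finset.univ := by
        rw [← Finset.card_eq_iff_eq_univ, h, Fintype.card_fin]
      have hxt : x ∈ t := this ▸ Finset.mem_univ x
      rw [← hft, Finset.mem_filter] at hxt
      exact hxt.2 hx
    · have ht : t ≠ Finset.univ := by
        rintro rfl
        simp at h
      rw [Finset.filter_filter]
      simp only [Finset.ext_iff, Finset.mem_filter, Finset.mem_univ, true_and]
      rw [← Fintype.card_subtype,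
        Fintype.card_congr (surjectiveFiberEquiv k t ht), card_surjective_eq_surjCount,
        Fintype.card_coe]
  rw [surjCount, Finset.card_eq_sum_card_fiberwise
    (f := fun f => Finset.univ.filter (fun x => f x ≠ 0)) (t := Finset.univ.powerset)
    (fun _ _ => by simp)]
  simp_rw [hfib]
  rw [Finset.sum_powerset_apply_card (fun m => (if m = n then 0 else surjCount m k : ℕ)),
    Finset.card_univ, Fintype.card_fin, Finset.sum_range_succ]
  simp only [if_true, smul_eq_mul, mul_zero, add_zero]
  refine Finset.sum_congr rfl fun j hj => ?_
  rw [if_neg (Finset.mem_range.1 hj).ne]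

theorem fubini_eq_sum_surjCount {n m : ℕ} (h : n ≤ m) :
    fubini n = ∑ k ∈ Finset.range (m + 1), surjCount n k := by
  refine Finset.sum_subset (Finset.range_subset_range.2 (by omega)) fun k _ hk => ?_
  exact surjCount_eq_zero_of_lt (by simpa [Nat.lt_succ_iff] using hk)

theorem fubini_succ (n : ℕ) :
    fubini (n + 1) = ∑ j ∈ Finset.range (n + 1), (n + 1).choose j * fubini j := by
  rw [fubini_eq_sum_surjCount le_rfl, Finset.sum_range_succ', surjCount_succ_zero, add_zero]
  simp_rw [surjCount_succ_right]
  rw [Finset.sum_comm]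
  refine Finset.sum_congr rfl fun j hj => ?_
  rw [← Finset.mul_sum, fubini_eq_sum_surjCount (Nat.lt_succ_iff.1 (Finset.mem_range.1 hj))]

theorem fubini_zero : fubini 0 = 1 := by
  simp [fubini, Function.Surjective]

theorem fubini_succ_div_factorial (n : ℕ) :
    (fubini (n + 1) : ℚ) / ((n + 1)! : ℚ) =
      ∑ j ∈ Finset.range (n + 1), 1 / ((n + 1 - j)! : ℚ) * ((fubini j : ℚ) / (j ! : ℚ)) := by
  rw [fubini_succ, Nat.cast_sum, Finset.sum_div]
  refine Finset.sum_congr rfl fun j hj => ?_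
  have hj' : j ≤ n + 1 := (Finset.mem_range.1 hj).le
  rw [Nat.cast_mul, Nat.cast_choose ℚ hj']
  have := Nat.factorial_ne_zero (n + 1)
  field_simp

/-- A Hessenberg-Toeplitz determinant equals the solution of its linear recurrence. -/
theorem det_hess_eq (R D : ℕ → ℚ) (h0 : D 0 = 1)
    (hD : ∀ n, D (n + 1) = ∑ j ∈ Finset.range (n + 1), (-1) ^ (n - j) * R (n - j + 1) * D j)
    (n : ℕ) : (hess R n).det = D n := by
  cases n with
  | zero => simp [h0]
  | succ n =>
    let v : Fin (n + 1) → ℚ := fun j => (-1) ^ (j : ℕ) * D j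
    have hsum (i : ℕ) : ∑ j ∈ Finset.range (i + 1), R (i - j + 1) * ((-1) ^ j * D j) =
        (-1) ^ i * D (i + 1) := by
      rw [hD, Finset.mul_sum]
      refine Finset.sum_congr rfl fun j hj => ?_
      have hji : j ≤ i := Nat.lt_succ_iff.1 (Finset.mem_range.1 hj)
      obtain ⟨d, rfl⟩ := Nat.exists_eq_add_of_le hji
      rw [Nat.add_sub_cancel_left, pow_add]
      have : ((-1 : ℚ) ^ d) * (-1) ^ d = 1 := by rw [← mul_pow]; simp
      linear_combination (-R (d + 1) * (-1) ^ j * D j) * this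
    have hv : (hess R (n + 1)).mulVec v = Pi.single (Fin.last n) ((-1) ^ n * D (n + 1)) := by
      ext i
      simp only [Matrix.mulVec, dotProduct, hess, Matrix.of_apply, v]
      rw [Fin.sum_univ_eq_sum_range (fun j => (if j ≤ (i : ℕ) then R ((i : ℕ) - j + 1)
        else if j = (i : ℕ) + 1 then 1 else 0) * ((-1) ^ j * D j)) (n + 1)]
      have hlow : ∑ j ∈ Finset.range ((i : ℕ) + 1), (if j ≤ (i : ℕ) then R ((i : ℕ) - j + 1)
          else if j = (i : ℕ) + 1 then 1 else 0) * ((-1) ^ j * D j) =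
          (-1) ^ (i : ℕ) * D (i + 1) := by
        rw [← hsum]
        refine Finset.sum_congr rfl fun j hj => ?_
        rw [if_pos (Nat.lt_succ_iff.1 (Finset.mem_range.1 hj))]
      induction i using Fin.lastCases with
      | last => simpa using hlow
      | cast i =>
        have hi : (i : ℕ) + 2 ≤ n + 1 := by omega
        rw [Pi.single_eq_of_ne (Fin.castSucc_lt_last i).ne,
          ← Finset.sum_subset (Finset.range_subset_range.2 hi), Finset.sum_range_succ]
        · simp only [Fin.val_castSucc] at hlow ⊢
          rw [hlow]
          simp [pow_succ]
        · intro j _ hj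
          simp only [Finset.mem_range, Fin.val_castSucc] at hj ⊢
          rw [if_neg (by omega), if_neg (by omega), zero_mul]
    have hminor : ((hess R (n + 1)).submatrix (Fin.last n).succAbove (Fin.succAbove 0)).det
        = 1 := by
      rw [Matrix.det_of_isLowerTriangular]
      · refine Finset.prod_eq_one fun i _ => ?_
        simp [hess]
      · intro i j hij
        have hij' : (i : ℕ) < j := hij
        simp only [hess, Matrix.submatrix_apply, Matrix.of_apply, Fin.succAbove_last,
          Fin.succAbove_zero, Fin.val_castSucc, Fin.val_succ]
        rw [if_neg (by omega), if_neg (by omega)]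
    have key := congrFun (Matrix.mulVec_mulVec v (hess R (n + 1)).adjugate (hess R (n + 1))) 0
    rw [hv, Matrix.adjugate_mul, Matrix.mulVec_single,
      Matrix.smul_mulVec, Matrix.one_mulVec] at key
    simp only [Pi.smul_apply, Matrix.col_apply, MulOpposite.smul_eq_mul_unop,
      MulOpposite.unop_op, smul_eq_mul] at key
    rw [Matrix.adjugate_fin_succ_eq_det_submatrix, hminor] at key
    have hs : ((-1 : ℚ) ^ n) * (-1) ^ n = 1 := by rw [← mul_pow]; simp
    simp only [v, Fin.val_zero, Fin.val_last, h0, pow_zero, mul_one, add_zero] at key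
    linear_combination -key + D (n + 1) * hs

theorem det_hess_eq_fubini (n : ℕ) :
    (hess (fun j => (-1 : ℚ) ^ (j - 1) / (j ! : ℚ)) n).det = (fubini n : ℚ) / (n ! : ℚ) := by
  refine det_hess_eq _ (fun n => (fubini n : ℚ) / (n ! : ℚ)) (by simp [fubini_zero])
    (fun n => ?_) n
  simp only [fubini_succ_div_factorial]
  refine Finset.sum_congr rfl fun j hj => ?_
  have hj' : j ≤ n := Nat.lt_succ_iff.1 (Finset.mem_range.1 hj)
  have hs : ((-1 : ℚ) ^ (n - j)) * (-1) ^ (n - j) = 1 := by rw [← mul_pow]; simp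
  rw [Nat.add_sub_cancel, Nat.sub_add_comm hj', mul_div_assoc' _ _ ((n - j + 1)! : ℚ), hs]

/-- The first position of the `k`-th gap between consecutive values of `ι`. -/
def gapStart {n l : ℕ} (ι : Fin (l + 1) → Fin n) : Fin (l + 2) → ℕ :=
  Fin.cons 0 fun k => (ι k : ℕ) + 1

/-- The first position after the `k`-th gap between consecutive values of `ι`. -/
def gapEnd {n l : ℕ} (ι : Fin (l + 1) → Fin n) : Fin (l + 2) → ℕ :=
  Fin.snoc (α := fun _ => ℕ) (fun k => (ι k : ℕ)) n

/-- The number of values of `ι` below `x`, which is the index of the gap containing `x`. -/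
def gapIndex {n l : ℕ} (ι : Fin (l + 1) → Fin n) (x : Fin n) : Fin (l + 2) :=
  ⟨(Finset.univ.filter fun k => ι k < x).card,
    Nat.lt_succ_of_le ((Finset.card_filter_le _ _).trans (by simp))⟩

section Gaps

variable {n l : ℕ} {ι : Fin (l + 1) → Fin n}

theorem castSucc_lt_gapIndex_iff (hι : StrictMono ι) (x : Fin n) (k : Fin (l + 1)) :
    k.castSucc < gapIndex ι x ↔ ι k < x := by
  rw [Fin.lt_def]
  simp only [Fin.val_castSucc, gapIndex]
  constructor
  · intro h
    by_contra! hx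
    have : (Finset.univ.filter fun j => ι j < x) ⊆ Finset.Iio k := fun j hj => by
      rw [Finset.mem_filter] at hj
      exact Finset.mem_Iio.2 (hι.lt_iff_lt.1 (hj.2.trans_le hx))
    have := Finset.card_le_card this
    rw [Fin.card_Iio] at this
    omega
  · intro h
    have : Finset.Iic k ⊆ Finset.univ.filter fun j => ι j < x := fun j hj =>
      Finset.mem_filter.2 ⟨Finset.mem_univ j, (hι.monotone (Finset.mem_Iic.1 hj)).trans_lt h⟩
    have := Finset.card_le_card this
    rw [Fin.card_Iic] at this
    omega

theorem gapStart_le_iff (hι : StrictMono ι) (x : Fin n) (k : Fin (l + 2)) :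
    gapStart ι k ≤ x ↔ k ≤ gapIndex ι x := by
  induction k using Fin.cases with
  | zero => simp [gapStart]
  | succ k =>
    rw [← Fin.castSucc_lt_iff_succ_le, castSucc_lt_gapIndex_iff hι, Fin.lt_def]
    simp [gapStart]

theorem lt_gapEnd_iff (hι : StrictMono ι) {x : Fin n} (hx : x ∉ Set.range ι) (k : Fin (l + 2)) :
    x < gapEnd ι k ↔ gapIndex ι x ≤ k := by
  induction k using Fin.lastCases with
  | last => simp [gapEnd, Fin.le_last]
  | cast k =>
    have hne : x ≠ ι k := fun h => hx ⟨k, h.symm⟩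
    rw [← not_lt, castSucc_lt_gapIndex_iff hι, not_lt, hne.le_iff_lt, Fin.lt_def]
    simp [gapEnd]

theorem gapIndex_eq_iff (hι : StrictMono ι) {x : Fin n} (hx : x ∉ Set.range ι)
    (k : Fin (l + 2)) : gapIndex ι x = k ↔ gapStart ι k ≤ x ∧ x < gapEnd ι k := by
  rw [gapStart_le_iff hι, lt_gapEnd_iff hι hx, le_antisymm_iff, and_comm]

theorem gapEnd_le (k : Fin (l + 2)) : gapEnd ι k ≤ n := by
  induction k using Fin.lastCases with
  | last => simp [gapEnd]
  | cast k => simp [gapEnd, (ι k).2.le]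

theorem notMem_range_of_mem_gap (hι : StrictMono ι) {x : Fin n} {k : Fin (l + 2)}
    (h₁ : gapStart ι k ≤ x) (h₂ : x < gapEnd ι k) : x ∉ Set.range ι := by
  rintro ⟨j, rfl⟩
  have hj : j.castSucc < k := by
    induction k using Fin.lastCases with
    | last => exact Fin.castSucc_lt_last j
    | cast k =>
      have : ι j < ι k := by simpa [gapEnd] using h₂
      exact Fin.castSucc_lt_castSucc_iff.2 (hι.lt_iff_lt.1 this)
  exact lt_irrefl (ι j)
    ((castSucc_lt_gapIndex_iff hι _ _).1 (hj.trans_le ((gapStart_le_iff hι _ _).1 h₁)))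

/-- Deleting the rows and columns listed by `ι` splits the determinant along the gaps of `ι`. -/
theorem det_hess_submatrix (R : ℕ → ℚ) (hι : StrictMono ι) {m : ℕ} (f : Fin m → Fin n)
    (hf : Function.Injective f) (hrange : ∀ x, x ∈ Set.range f ↔ x ∉ Set.range ι) :
    ((hess R n).submatrix f f).det = ∏ k, (hess R (gapEnd ι k - gapStart ι k)).det := by
  have hfι (a : Fin m) : f a ∉ Set.range ι := (hrange _).1 ⟨a, rfl⟩
  have hblock : ((hess R n).submatrix f f).transpose.BlockTriangular fun a => gapIndex ι (f a) := by
    intro a b hab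
    obtain ⟨k, hk⟩ := Fin.exists_castSucc_eq.2 (Fin.ne_last_of_lt hab)
    have ha : ι k < f a := (castSucc_lt_gapIndex_iff hι _ _).1 (hk ▸ hab)
    have hb : f b ≤ ι k := not_lt.1 fun h =>
      hk.not_lt ((castSucc_lt_gapIndex_iff hι _ _).2 h)
    have hb' : f b < ι k := hb.lt_of_ne fun h => hfι b ⟨k, h.symm⟩
    simp only [hess, Matrix.transpose_apply, Matrix.submatrix_apply, Matrix.of_apply]
    rw [if_neg (by omega), if_neg (by omega)]
  rw [← Matrix.det_transpose, hblock.det_fintype]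
  refine Finset.prod_congr rfl fun k _ => ?_
  have hmem (a : {a : Fin m // gapIndex ι (f a) = k}) := (gapIndex_eq_iff hι (hfι a) k).1 a.2
  let g (a : {a : Fin m // gapIndex ι (f a) = k}) : Fin (gapEnd ι k - gapStart ι k) :=
    ⟨f a - gapStart ι k, by have := hmem a; omega⟩
  have hg : Function.Bijective g := by
    constructor
    · intro a b hab
      have h := Fin.val_eq_of_eq hab
      have ha := hmem a
      have hb := hmem b
      simp only [g] at h
      exact Subtype.ext (hf (Fin.ext (by omega)))
    · intro y
      have hy := y.2
      have hle := gapEnd_le (ι := ι) k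
      let x : Fin n := ⟨gapStart ι k + y, by omega⟩
      have hx₁ : gapStart ι k ≤ x := Nat.le_add_right _ _
      have hx₂ : x < gapEnd ι k := by simp only [x]; omega
      have hx := notMem_range_of_mem_gap hι hx₁ hx₂
      obtain ⟨a, ha⟩ := (hrange x).2 hx
      exact ⟨⟨a, by rw [ha, gapIndex_eq_iff hι hx]; exact ⟨hx₁, hx₂⟩⟩,
        Fin.ext (by simp [g, ha, x])⟩
  rw [← Matrix.det_submatrix_equiv_self (Equiv.ofBijective g hg), ← Matrix.det_transpose]
  congr 1
  ext a b
  have ha := (hmem a).1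
  have hb := (hmem b).1
  simp only [hess, Matrix.toSquareBlock_def, Matrix.transpose_apply, Matrix.submatrix_apply,
    Matrix.of_apply, Equiv.ofBijective_apply, g]
  congr 1
  · simp only [eq_iff_iff]
    omega
  · congr 1
    omega
  · congr 1
    simp only [eq_iff_iff]
    omega

end Gaps
/-- The principal minor of `T_n = H_n(R)` with `R j = (-1)^(j-1)/j!` obtained by
deleting the rows and columns with (1-based) indices `i_1 < ⋯ < i_l`, here given by
the strictly monotone family `ι : Fin (l+1) → Fin n` of 0-based indices
(so `i_k = ι (k-1) + 1`), equals
`(F_{i_1-1}/(i_1-1)!) ⬝ ∏_{k=2}^{l} (F_{i_k-i_{k-1}-1}/(i_k-i_{k-1}-1)!) ⬝ (F_{n-i_l}/(n-i_l)!)`. -/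
theorem principal_minor_eq (n : ℕ) (hn : 1 ≤ n) (l : ℕ)
    (ι : Fin (l + 1) → Fin n) (hι : StrictMono ι) :
    ((hess (fun j => (-1 : ℚ) ^ (j - 1) / (j ! : ℚ)) n).submatrix
        (fun a => (Finset.univ \ Finset.image ι Finset.univ).orderEmbOfFin rfl a)
        (fun a => (Finset.univ \ Finset.image ι Finset.univ).orderEmbOfFin rfl a)).det =
      ((fubini (ι 0) : ℚ) / ((ι 0 : ℕ)! : ℚ)) *
        (∏ k : Fin l,
          (fubini ((ι k.succ : ℕ) - (ι k.castSucc : ℕ) - 1) : ℚ) /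
            ((((ι k.succ : ℕ) - (ι k.castSucc : ℕ) - 1)!) : ℚ)) *
        ((fubini (n - (ι (Fin.last l) : ℕ) - 1) : ℚ) /
          (((n - (ι (Fin.last l) : ℕ) - 1)!) : ℚ)) := by
  rw [det_hess_submatrix _ hι _ (RelEmbedding.injective _)]
  · simp_rw [det_hess_eq_fubini]
    rw [Fin.prod_univ_castSucc, Fin.prod_univ_succ]
    simp only [gapEnd, Fin.snoc_castSucc, Fin.snoc_last]
    simp only [gapStart, ← Fin.succ_last, Fin.castSucc_zero, Fin.cons_zero, Fin.cons_succ,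
      ← Fin.succ_castSucc, Nat.sub_zero, Nat.sub_sub]
  · intro x
    rw [Finset.range_orderEmbOfFin]
    simp
end
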